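/- Let q be a nonnegative integer and r a real with 0 ≤ r < 1. The function h(P) = (−(q + 1 − P + r) + √((q + 1 − P + r)² + 4P))/2 is monotone non-decreasing in P on the real interval (0, q + 1]. -/

import Mathlib

/-- The pre-floor count of wasted retries is non-decreasing on (0, q+1]. -/
theorem wasted_retries_monotone_low
    (q : ℕ) (r : ℝ) (hr0 : 0 ≤ r) (hr1 : r < 1) :
    MonotoneOn
      (fun P : ℝ =>
        (-((q : ℝ) + 1 - P + r) +
          Real.sqrt (((q : ℝ) + 1 - P + r) ^ 2 + 4 * P)) / 2)
      (Set.Ioc 0 ((q : ℝ) + 1)) := by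
  rintro x ⟨hx, -⟩ y - hxy
  dsimp only
  have hnonneg : 0 ≤ ((q : ℝ) + 1 - x + r) ^ 2 + 4 * x := by positivity
  have hsq := Real.sq_sqrt hnonneg
  have hle : (q : ℝ) + 1 - x + r ≤ Real.sqrt (((q : ℝ) + 1 - x + r) ^ 2 + 4 * x) :=
    Real.le_sqrt_of_sq_le (by linarith)
  set S := Real.sqrt (((q : ℝ) + 1 - x + r) ^ 2 + 4 * x)
  have hS : S - (y - x) ≤ Real.sqrt (((q : ℝ) + 1 - y + r) ^ 2 + 4 * y) := by
    apply Real.le_sqrt_of_sq_le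
    have hprod : 0 ≤ (y - x) * (S - (q + 1 - x + r) + 2) :=
      mul_nonneg (by linarith) (by linarith)
    linarith
  linarith
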